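/- (Corollary 4.1) For every α ∈ [−1,1] and all integers 0 ≤ i, j ≤ ⌊λ⌋−1 with i + j ≤ ⌈λ⌉−1, the α-divergence expressed in the chart φ̃, i.e. the map L^λ(μ) × L^λ(μ) → ℝ, (ã, b̃) ↦ D_α(φ̃^{-1}(ã) | φ̃^{-1}(b̃)), is of class C^{i,j}: it admits continuous partial Fréchet derivatives of order i in the first variable and order j in the second variable. -/

import Mathlib

open MeasureTheory Real Set

section

open Filter Topology

section Nemytskii

variable {X : Type*} [MeasurableSpace X] {μ : Measure X}

/-- A function of growth order `m` maps sequences converging in `L^lam` to sequences converging in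
`L^(lam / m)`. -/
theorem tendsto_eLpNorm_comp_sub [IsFiniteMeasure μ] {E : Type*} [NormedAddCommGroup E]
    {lam : ℝ} [Fact (1 ≤ ENNReal.ofReal lam)] {m : ℝ} (hm : 0 < m) (hml : m ≤ lam)
    {Φ : E → ℝ} (hΦ : Continuous Φ) {C : ℝ} (hC : ∀ z, |Φ z| ≤ C * (1 + ‖z‖) ^ m)
    (u : Lp E (ENNReal.ofReal lam) μ) :
    Tendsto (fun v : Lp E (ENNReal.ofReal lam) μ =>
      eLpNorm (fun x => Φ (v x) - Φ (u x)) (ENNReal.ofReal (lam / m)) μ) (𝓝 u) (𝓝 0) := by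
  have hlam : 0 < lam := hm.trans_le hml
  have hC0 : 0 ≤ C := by
    have := (abs_nonneg _).trans (hC 0)
    simpa using this
  have hp1 : (1 : ENNReal) ≤ ENNReal.ofReal lam := Fact.out
  have hr1 : (1 : ENNReal) ≤ ENNReal.ofReal (lam / m) := by
    rw [← ENNReal.ofReal_one]
    exact ENNReal.ofReal_le_ofReal ((one_le_div hm).2 hml)
  have hexp : ENNReal.ofReal (lam / m) * ENNReal.ofReal m = ENNReal.ofReal lam := by
    rw [← ENNReal.ofReal_mul (by positivity), div_mul_cancel₀ _ hm.ne']
  have hmeas (v : Lp E (ENNReal.ofReal lam) μ) : AEStronglyMeasurable (fun x => Φ (v x)) μ :=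
    hΦ.comp_aestronglyMeasurable (Lp.aestronglyMeasurable v)
  have hbound (v : X → E) (s : Set X) :
      eLpNorm (s.indicator fun x => Φ (v x)) (ENNReal.ofReal (lam / m)) μ ≤
        ENNReal.ofReal C * eLpNorm (s.indicator fun x => 1 + ‖v x‖) (ENNReal.ofReal lam) μ ^ m := by
    rw [← hexp, ← eLpNorm_norm_rpow _ hm]
    have : ENNReal.ofReal C = ‖C‖ₑ := by rw [Real.enorm_eq_ofReal hC0]
    rw [this, ← eLpNorm_const_smul]
    refine eLpNorm_mono_real fun x => ?_
    by_cases hx : x ∈ s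
    · have h1 : |1 + ‖v x‖| = 1 + ‖v x‖ := abs_of_nonneg (by positivity)
      simpa [hx, h1] using hC (v x)
    · simp [hx, Real.zero_rpow hm.ne']
  have hone (v : Lp E (ENNReal.ofReal lam) μ) :
      MemLp (fun x => 1 + ‖v x‖) (ENNReal.ofReal lam) μ :=
    MemLp.add (f := fun _ => (1 : ℝ)) (g := fun x => ‖v x‖) (memLp_const 1) (Lp.memLp v).norm
  have hmem (v : Lp E (ENNReal.ofReal lam) μ) :
      MemLp (fun x => Φ (v x)) (ENNReal.ofReal (lam / m)) μ := by
    refine ⟨hmeas v, ?_⟩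
    have := hbound v univ
    simp only [indicator_univ] at this
    exact this.trans_lt (ENNReal.mul_lt_top ENNReal.ofReal_lt_top
      (ENNReal.rpow_lt_top_of_nonneg hm.le (hone v).eLpNorm_lt_top.ne))
  refine tendsto_of_subseq_tendsto fun v hv => ?_
  have hv' : Tendsto (fun n => eLpNorm (v n - u : X → E) (ENNReal.ofReal lam) μ) atTop (𝓝 0) :=
    (Lp.tendsto_Lp_iff_tendsto_eLpNorm' _ _).1 hv
  obtain ⟨ns, hns, hae⟩ := (tendstoInMeasure_of_tendsto_eLpNorm (zero_lt_one.trans_le hp1).ne'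
    (fun n => Lp.aestronglyMeasurable (v n)) (Lp.aestronglyMeasurable u) hv').exists_seq_tendsto_ae
  refine ⟨ns, tendsto_Lp_finite_of_tendsto_ae hr1 ENNReal.ofReal_ne_top
    (f := fun n x => Φ (v (ns n) x)) (g := fun x => Φ (u x)) (fun n => hmeas _) (hmem u) ?_ ?_⟩
  · have hui : UnifIntegrable (fun n x => 1 + ‖v (ns n) x‖) (ENNReal.ofReal lam) μ := by
      refine UnifIntegrable.add (f := fun _ _ => (1 : ℝ)) (g := fun n x => ‖v (ns n) x‖)
        (unifIntegrable_const hp1 ENNReal.ofReal_ne_top (memLp_const 1)) ?_ hp1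
        (fun _ => aestronglyMeasurable_const) (fun n => (Lp.aestronglyMeasurable _).norm)
      have := unifIntegrable_of_tendsto_Lp hp1 ENNReal.ofReal_ne_top
        (fun n => Lp.memLp (v (ns n))) (Lp.memLp u) (hv'.comp hns.tendsto_atTop)
      intro ε hε
      obtain ⟨δ, hδ, h⟩ := this hε
      refine ⟨δ, hδ, fun n s hs hμ => (le_of_eq ?_).trans (h n s hs hμ)⟩
      refine eLpNorm_congr_norm_ae (ae_of_all _ fun x => ?_)
      by_cases hx : x ∈ s <;> simp [hx]
    intro ε hε
    have hC1 : 0 < C + 1 := by linarith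
    obtain ⟨δ, hδ, h⟩ := hui (ε := (ε / (C + 1)) ^ m⁻¹) (by positivity)
    refine ⟨δ, hδ, fun n s hs hμ => (hbound _ s).trans ?_⟩
    calc _ ≤ ENNReal.ofReal C * ENNReal.ofReal ((ε / (C + 1)) ^ m⁻¹) ^ m := by
          gcongr; exact h n s hs hμ
      _ ≤ ENNReal.ofReal ε := by
          rw [ENNReal.ofReal_rpow_of_nonneg (by positivity) hm.le, ← Real.rpow_mul (by positivity),
            inv_mul_cancel₀ hm.ne', Real.rpow_one, ← ENNReal.ofReal_mul hC0]
          refine ENNReal.ofReal_le_ofReal ?_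
          rw [← mul_div_assoc, div_le_iff₀ hC1]
          nlinarith
  · filter_upwards [hae] with x hx
    exact (hΦ.tendsto _).comp hx

theorem memLp_comp_of_growth [IsFiniteMeasure μ] {E : Type*} [NormedAddCommGroup E]
    {lam : ℝ} {m : ℝ} (hm : 0 < m)
    {Φ : E → ℝ} (hΦ : Continuous Φ) {C : ℝ} (hC : ∀ z, |Φ z| ≤ C * (1 + ‖z‖) ^ m)
    {u : X → E} (hu : MemLp u (ENNReal.ofReal lam) μ) :
    MemLp (fun x => Φ (u x)) (ENNReal.ofReal (lam / m)) μ := by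
  have h1 : MemLp (fun x => 1 + ‖u x‖) (ENNReal.ofReal lam) μ :=
    MemLp.add (f := fun _ => (1 : ℝ)) (g := fun x => ‖u x‖) (memLp_const 1) hu.norm
  have h2 := h1.norm_rpow_div (ENNReal.ofReal m)
  rw [ENNReal.toReal_ofReal hm.le, ← ENNReal.ofReal_div_of_pos hm] at h2
  refine (h2.const_mul C).mono (hΦ.comp_aestronglyMeasurable hu.1) (ae_of_all _ fun x => ?_)
  have h1 : ‖1 + ‖u x‖‖ = 1 + ‖u x‖ := Real.norm_of_nonneg (by positivity)
  rw [h1, Real.norm_eq_abs, Real.norm_eq_abs]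
  exact (hC _).trans (le_abs_self _)

/-- The pairing of two `L^p` functions. -/
noncomputable def pairLp {E F : Type*} [NormedAddCommGroup E] [NormedSpace ℝ E]
    [NormedAddCommGroup F] [NormedSpace ℝ F] {p : ENNReal} (f : Lp E p μ) (g : Lp F p μ) :
    Lp (E × F) p μ :=
  (ContinuousLinearMap.inl ℝ E F).compLp f + (ContinuousLinearMap.inr ℝ E F).compLp g

theorem coeFn_pairLp {E F : Type*} [NormedAddCommGroup E] [NormedSpace ℝ E]
    [NormedAddCommGroup F] [NormedSpace ℝ F] {p : ENNReal} (f : Lp E p μ) (g : Lp F p μ) :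
    pairLp f g =ᵐ[μ] fun x => (f x, g x) := by
  filter_upwards [Lp.coeFn_add ((ContinuousLinearMap.inl ℝ E F).compLp f)
      ((ContinuousLinearMap.inr ℝ E F).compLp g),
    (ContinuousLinearMap.inl ℝ E F).coeFn_compLp f,
    (ContinuousLinearMap.inr ℝ E F).coeFn_compLp g] with x h1 h2 h3
  rw [pairLp, h1, Pi.add_apply, h2, h3]
  simp

theorem continuous_pairLp {E F : Type*} [NormedAddCommGroup E] [NormedSpace ℝ E]
    [NormedAddCommGroup F] [NormedSpace ℝ F] {p : ENNReal} [Fact (1 ≤ p)] :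
    Continuous fun q : Lp E p μ × Lp F p μ => pairLp q.1 q.2 :=
  (((ContinuousLinearMap.inl ℝ E F).compLpL p μ).continuous.comp continuous_fst).add
    (((ContinuousLinearMap.inr ℝ E F).compLpL p μ).continuous.comp continuous_snd)

theorem tendsto_eLpNorm_comp₂_sub [IsFiniteMeasure μ] {E F : Type*}
    [NormedAddCommGroup E] [NormedSpace ℝ E] [NormedAddCommGroup F] [NormedSpace ℝ F]
    {lam : ℝ} [Fact (1 ≤ ENNReal.ofReal lam)] {m : ℝ} (hm : 0 < m) (hml : m ≤ lam)
    {Φ : E × F → ℝ} (hΦ : Continuous Φ) {C : ℝ} (hC : ∀ z, |Φ z| ≤ C * (1 + ‖z‖) ^ m)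
    (u : Lp E (ENNReal.ofReal lam) μ × Lp F (ENNReal.ofReal lam) μ) :
    Tendsto (fun v : Lp E (ENNReal.ofReal lam) μ × Lp F (ENNReal.ofReal lam) μ =>
      eLpNorm (fun x => Φ (v.1 x, v.2 x) - Φ (u.1 x, u.2 x)) (ENNReal.ofReal (lam / m)) μ)
      (𝓝 u) (𝓝 0) := by
  refine ((tendsto_eLpNorm_comp_sub hm hml hΦ hC (pairLp u.1 u.2)).comp
    (continuous_pairLp.tendsto u)).congr fun v => eLpNorm_congr_ae ?_
  filter_upwards [coeFn_pairLp v.1 v.2, coeFn_pairLp u.1 u.2] with x h1 h2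
  rw [h1, h2]

end Nemytskii

section Forms

variable {X : Type*} [MeasurableSpace X] {μ : Measure X}

theorem eLpNorm_mul_prod_le {ι : Type*} (s : Finset ι) {p q : ENNReal} {h : ι → X → ℝ}
    (hh : ∀ i, AEStronglyMeasurable (h i) μ) (r : ENNReal) (w : X → ℝ)
    (hw : AEStronglyMeasurable w μ) (hr : r⁻¹ + s.card * p⁻¹ = q⁻¹) :
    eLpNorm (fun x => w x * ∏ i ∈ s, h i x) q μ ≤ eLpNorm w r μ * ∏ i ∈ s, eLpNorm (h i) p μ := by
  induction s using Finset.cons_induction generalizing r w with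
  | empty =>
    obtain rfl : r = q := by simpa using hr
    simp
  | cons i s hi ih =>
    simp only [Finset.prod_cons, ← mul_assoc]
    have : ENNReal.HolderTriple r p (r⁻¹ + p⁻¹)⁻¹ := ⟨by simp⟩
    refine (ih (r⁻¹ + p⁻¹)⁻¹ (fun x => w x * h i x) (hw.mul (hh i)) ?_).trans ?_
    · rw [← hr, inv_inv, Finset.card_cons]
      push_cast
      ring
    · gcongr
      exact eLpNorm_smul_le_mul_eLpNorm (φ := w) (f := h i) (hh i) hw

/-- The exponent `lam / (lam - k)`, Hölder conjugate to `k` factors in `L^lam`. -/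
noncomputable def coExp (lam : ℝ) (k : ℕ) : ENNReal := ENNReal.ofReal (lam / (lam - k))

theorem inv_coExp {lam : ℝ} {k : ℕ} (hlam : 0 < lam) (hk : (k : ℝ) < lam) :
    (coExp lam k)⁻¹ = ENNReal.ofReal ((lam - k) / lam) := by
  rw [coExp, ← ENNReal.ofReal_inv_of_pos (div_pos hlam (by linarith)), inv_div]

theorem inv_coExp_add {lam : ℝ} {k l : ℕ} (hlam : 0 < lam) (hk : ((l + k : ℕ) : ℝ) < lam) :
    (coExp lam (l + k))⁻¹ + k * (ENNReal.ofReal lam)⁻¹ = (coExp lam l)⁻¹ := by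
  have : (l : ℝ) < lam := lt_of_le_of_lt (by simp) hk
  push_cast at hk
  rw [inv_coExp hlam this, inv_coExp hlam (by push_cast; exact hk),
    ← ENNReal.ofReal_inv_of_pos hlam, ← ENNReal.ofReal_natCast,
    ← ENNReal.ofReal_mul (by positivity), ← ENNReal.ofReal_add _ (by positivity)]
  · congr 1
    push_cast
    field_simp
    ring
  · exact div_nonneg (by push_cast; linarith) hlam.le

theorem coExp_zero {lam : ℝ} (hlam : 0 < lam) : coExp lam 0 = 1 := by
  simp [coExp, hlam.ne']

variable {lam : ℝ} {ι : Type*} [Fintype ι]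

theorem eLpNorm_mul_prod_Lp_le (hlam : 0 < lam) (hk : (Fintype.card ι : ℝ) < lam) {w : X → ℝ}
    (hw : AEStronglyMeasurable w μ) (h : ι → Lp ℝ (ENNReal.ofReal lam) μ) :
    eLpNorm (fun x => w x * ∏ i, h i x) 1 μ ≤
      eLpNorm w (coExp lam (Fintype.card ι)) μ * ∏ i, eLpNorm (h i) (ENNReal.ofReal lam) μ := by
  refine eLpNorm_mul_prod_le _ (fun i => Lp.aestronglyMeasurable _) _ _ hw ?_
  have := inv_coExp_add (l := 0) (k := Fintype.card ι) hlam (by simpa using hk)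
  rwa [zero_add, coExp_zero hlam] at this

theorem integrable_mul_prod_Lp (hlam : 0 < lam) (hk : (Fintype.card ι : ℝ) < lam) {w : X → ℝ}
    (hw : MemLp w (coExp lam (Fintype.card ι)) μ) (h : ι → Lp ℝ (ENNReal.ofReal lam) μ) :
    Integrable (fun x => w x * ∏ i, h i x) μ := by
  rw [← memLp_one_iff_integrable]
  refine ⟨hw.1.mul (Finset.aestronglyMeasurable_fun_prod _
    fun i _ => Lp.aestronglyMeasurable (h i)), ?_⟩
  exact (eLpNorm_mul_prod_Lp_le hlam hk hw.1 h).trans_lt (ENNReal.mul_lt_top hw.2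
    (ENNReal.prod_lt_top fun i _ => Lp.eLpNorm_lt_top _))

theorem abs_integral_mul_prod_Lp_le (hlam : 0 < lam) (hk : (Fintype.card ι : ℝ) < lam)
    {w : X → ℝ} (hw : MemLp w (coExp lam (Fintype.card ι)) μ)
    (h : ι → Lp ℝ (ENNReal.ofReal lam) μ) :
    |∫ x, w x * ∏ i, h i x ∂μ| ≤
      (eLpNorm w (coExp lam (Fintype.card ι)) μ).toReal * ∏ i, ‖h i‖ := by
  rw [← Real.norm_eq_abs]
  have h1 : ‖∫ x, w x * ∏ i, h i x ∂μ‖ₑ ≤ _ :=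
    (enorm_integral_le_lintegral_enorm _).trans
      (eLpNorm_one_eq_lintegral_enorm.symm.trans_le (eLpNorm_mul_prod_Lp_le hlam hk hw.1 h))
  have h2 := ENNReal.toReal_mono (ENNReal.mul_lt_top hw.2
    (ENNReal.prod_lt_top fun i _ => Lp.eLpNorm_lt_top (h i))).ne h1
  simpa [ENNReal.toReal_mul, ENNReal.toReal_prod, Lp.norm_def] using h2

variable [Fact (1 ≤ ENNReal.ofReal lam)]

variable (lam μ ι) in
open Classical in
/-- The multilinear form `h ↦ ∫ w ∏ i, h i` on `L^lam`; it is zero when the integrability condition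
on the weight `w` fails. -/
noncomputable def mulForm (w : X → ℝ) :
    ContinuousMultilinearMap ℝ (fun _ : ι => Lp ℝ (ENNReal.ofReal lam) μ) ℝ :=
  if hw : 0 < lam ∧ (Fintype.card ι : ℝ) < lam ∧ MemLp w (coExp lam (Fintype.card ι)) μ then
    MultilinearMap.mkContinuous
      { toFun := fun h => ∫ x, w x * ∏ i, h i x ∂μ
        map_update_add' := fun {inst} h i f g => by
          obtain rfl : inst = fun a b => Classical.propDecidable (a = b) := Subsingleton.elim _ _
          rw [← integral_add (integrable_mul_prod_Lp hw.1 hw.2.1 hw.2.2 _)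
            (integrable_mul_prod_Lp hw.1 hw.2.1 hw.2.2 _)]
          refine integral_congr_ae ?_
          filter_upwards [Lp.coeFn_add f g] with x hx
          simp only [Function.apply_update (fun _ (k : Lp ℝ (ENNReal.ofReal lam) μ) => k x),
            Finset.prod_update_of_mem (Finset.mem_univ i), hx, Pi.add_apply]
          ring
        map_update_smul' := fun {inst} h i c f => by
          obtain rfl : inst = fun a b => Classical.propDecidable (a = b) := Subsingleton.elim _ _
          rw [smul_eq_mul, ← integral_const_mul]
          refine integral_congr_ae ?_
          filter_upwards [Lp.coeFn_smul c f] with x hx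
          simp only [Function.apply_update (fun _ (k : Lp ℝ (ENNReal.ofReal lam) μ) => k x),
            Finset.prod_update_of_mem (Finset.mem_univ i), hx, Pi.smul_apply, smul_eq_mul]
          ring }
      (eLpNorm w (coExp lam (Fintype.card ι)) μ).toReal
      (fun h => abs_integral_mul_prod_Lp_le hw.1 hw.2.1 hw.2.2 h)
  else 0

theorem mulForm_apply (hlam : 0 < lam) (hk : (Fintype.card ι : ℝ) < lam) {w : X → ℝ}
    (hw : MemLp w (coExp lam (Fintype.card ι)) μ) (h : ι → Lp ℝ (ENNReal.ofReal lam) μ) :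
    mulForm μ lam ι w h = ∫ x, w x * ∏ i, h i x ∂μ := by
  rw [mulForm, dif_pos ⟨hlam, hk, hw⟩]
  rfl

theorem norm_mulForm_sub_le (hlam : 0 < lam) (hk : (Fintype.card ι : ℝ) < lam) {w w' : X → ℝ}
    (hw : MemLp w (coExp lam (Fintype.card ι)) μ)
    (hw' : MemLp w' (coExp lam (Fintype.card ι)) μ) :
    ‖mulForm μ lam ι w - mulForm μ lam ι w'‖ ≤
      (eLpNorm (fun x => w x - w' x) (coExp lam (Fintype.card ι)) μ).toReal := by
  refine ContinuousMultilinearMap.opNorm_le_bound ENNReal.toReal_nonneg fun h => ?_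
  rw [sub_apply, mulForm_apply hlam hk hw, mulForm_apply hlam hk hw',
    ← integral_sub (integrable_mul_prod_Lp hlam hk hw h) (integrable_mul_prod_Lp hlam hk hw' h)]
  simp only [← sub_mul]
  exact abs_integral_mul_prod_Lp_le hlam hk (hw.sub hw') h

end Forms

section Growth

/-- A continuous function of growth order at most `m`. -/
def PolyGrowth {E : Type*} [NormedAddCommGroup E] (m : ℝ) (Φ : E → ℝ) : Prop :=
  Continuous Φ ∧ ∃ C, ∀ z, |Φ z| ≤ C * (1 + ‖z‖) ^ m

theorem PolyGrowth.nonneg_of_bound {E : Type*} [NormedAddCommGroup E] {m C : ℝ} {Φ : E → ℝ}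
    (hC : ∀ z, |Φ z| ≤ C * (1 + ‖z‖) ^ m) : 0 ≤ C := by
  simpa using (abs_nonneg _).trans (hC 0)

theorem PolyGrowth.comp_swap {m : ℝ} {φ : ℝ → ℝ → ℝ}
    (h : PolyGrowth m (fun z : ℝ × ℝ => φ z.1 z.2)) :
    PolyGrowth m (fun z : ℝ × ℝ => φ z.2 z.1) := by
  obtain ⟨hc, C, hC⟩ := h
  refine ⟨hc.comp continuous_swap, C, fun z => ?_⟩
  have := hC z.swap
  simpa [Prod.norm_def, max_comm] using this

theorem PolyGrowth.intervalIntegral {m : ℝ} (hm : 0 ≤ m) {φ : ℝ → ℝ → ℝ}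
    (h : PolyGrowth m (fun z : ℝ × ℝ => φ z.1 z.2)) :
    PolyGrowth m (fun z : ℝ × ℝ × ℝ => ∫ t in (0 : ℝ)..1, φ (z.1 + t * z.2.2) z.2.1) := by
  obtain ⟨hc, C, hC⟩ := h
  have hC0 := PolyGrowth.nonneg_of_bound hC
  refine ⟨?_, C * 2 ^ m, fun z => ?_⟩
  · refine intervalIntegral.continuous_parametric_intervalIntegral_of_continuous' ?_ 0 1
    exact hc.comp (g := fun z : ℝ × ℝ => φ z.1 z.2)
      (f := fun w : (ℝ × ℝ × ℝ) × ℝ => (w.1.1 + w.2 * w.1.2.2, w.1.2.1)) (by fun_prop)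
  · rw [← Real.norm_eq_abs]
    have := intervalIntegral.norm_integral_le_of_norm_le_const (a := (0 : ℝ)) (b := 1)
      (f := fun t => φ (z.1 + t * z.2.2) z.2.1) (C := C * 2 ^ m * (1 + ‖z‖) ^ m) fun t ht => ?_
    · simpa using this
    · rw [uIoc_of_le zero_le_one] at ht
      refine (hC (z.1 + t * z.2.2, z.2.1)).trans ?_
      rw [mul_assoc, ← Real.mul_rpow (by norm_num) (by positivity)]
      gcongr
      have h1 : ‖z.1‖ ≤ ‖z‖ := norm_fst_le z
      have h2 : ‖z.2.1‖ ≤ ‖z‖ := (norm_fst_le z.2).trans (norm_snd_le z)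
      have h3 : ‖z.2.2‖ ≤ ‖z‖ := (norm_snd_le z.2).trans (norm_snd_le z)
      have h4 : ‖z.1 + t * z.2.2‖ ≤ ‖z‖ + ‖z‖ := by
        refine (norm_add_le _ _).trans (add_le_add h1 ?_)
        rw [norm_mul, Real.norm_of_nonneg ht.1.le]
        exact (mul_le_of_le_one_left (norm_nonneg _) ht.2).trans h3
      have h5 : ‖(z.1 + t * z.2.2, z.2.1)‖ ≤ ‖z‖ + ‖z‖ :=
        max_le h4 (h2.trans (le_add_of_nonneg_left (norm_nonneg _)))
      linarith

theorem integral_segment_mul {φ φ' : ℝ → ℝ → ℝ} (hc : Continuous fun z : ℝ × ℝ => φ' z.1 z.2)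
    (hd : ∀ x y, HasDerivAt (fun s => φ s y) (φ' x y) x) (x y d : ℝ) :
    φ (x + d) y - φ x y = (∫ t in (0 : ℝ)..1, φ' (x + t * d) y) * d := by
  have hcont : Continuous fun t : ℝ => φ' (x + t * d) y * d :=
    (hc.comp (f := fun t : ℝ => (x + t * d, y)) (by fun_prop)).mul continuous_const
  have := intervalIntegral.integral_eq_sub_of_hasDerivAt (a := (0 : ℝ)) (b := 1)
    (f := fun t => φ (x + t * d) y) (f' := fun t => φ' (x + t * d) y * d)
    (fun t _ => by
      have h1 : HasDerivAt (fun t : ℝ => x + t * d) d t := by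
        simpa using ((hasDerivAt_id t).mul_const d).const_add x
      exact (hd (x + t * d) y).comp t h1) (hcont.intervalIntegrable _ _)
  rw [intervalIntegral.integral_mul_const] at this
  simpa using this.symm

end Growth

section Derivative

variable {X : Type*} [MeasurableSpace X] {μ : Measure X} [IsFiniteMeasure μ] {lam : ℝ}
  {ι : Type*} [Fintype ι]

theorem PolyGrowth.memLp {k : ℕ} (hk : (k : ℝ) < lam) {φ : ℝ → ℝ → ℝ}
    (h : PolyGrowth (lam - k) (fun z : ℝ × ℝ => φ z.1 z.2))
    (a b : Lp ℝ (ENNReal.ofReal lam) μ) :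
    MemLp (fun x => φ (a x) (b x)) (coExp lam k) μ := by
  obtain ⟨hc, C, hC⟩ := h
  refine (memLp_comp_of_growth (sub_pos.2 hk) hc hC (Lp.memLp (pairLp a b))).ae_eq ?_
  filter_upwards [coeFn_pairLp a b] with x hx
  rw [hx]

variable [Fact (1 ≤ ENNReal.ofReal lam)]

theorem continuous_mulForm (hlam : 0 < lam) (hk : (Fintype.card ι : ℝ) < lam) {φ : ℝ → ℝ → ℝ}
    (h : PolyGrowth (lam - Fintype.card ι) (fun z : ℝ × ℝ => φ z.1 z.2)) :
    Continuous fun q : Lp ℝ (ENNReal.ofReal lam) μ × Lp ℝ (ENNReal.ofReal lam) μ =>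
      mulForm μ lam ι (fun x => φ (q.1 x) (q.2 x)) := by
  have hmem := h.memLp hk (μ := μ)
  obtain ⟨hc, C, hC⟩ := h
  refine continuous_iff_continuousAt.2 fun u => tendsto_iff_norm_sub_tendsto_zero.2 ?_
  refine squeeze_zero (fun _ => norm_nonneg _)
    (fun v => norm_mulForm_sub_le hlam hk (hmem v.1 v.2) (hmem u.1 u.2)) ?_
  rw [← ENNReal.toReal_zero]
  exact (ENNReal.tendsto_toReal ENNReal.zero_ne_top).comp
    (tendsto_eLpNorm_comp₂_sub (sub_pos.2 hk) (sub_le_self _ (Nat.cast_nonneg _)) hc hC u)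

theorem hasFDerivAt_mulForm (hlam : 0 < lam) (hk : ((Fintype.card ι + 1 : ℕ) : ℝ) < lam)
    {φ φ' : ℝ → ℝ → ℝ}
    (hφ : PolyGrowth (lam - Fintype.card ι) (fun z : ℝ × ℝ => φ z.1 z.2))
    (hφ' : PolyGrowth (lam - (Fintype.card ι + 1 : ℕ)) (fun z : ℝ × ℝ => φ' z.1 z.2))
    (hd : ∀ x y, HasDerivAt (fun s => φ s y) (φ' x y) x)
    (a b : Lp ℝ (ENNReal.ofReal lam) μ)
    {T' : Lp ℝ (ENNReal.ofReal lam) μ →L[ℝ]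
      ContinuousMultilinearMap ℝ (fun _ : ι => Lp ℝ (ENNReal.ofReal lam) μ) ℝ}
    (hT' : ∀ d h, T' d h = ∫ x, φ' (a x) (b x) * (d x * ∏ i, h i x) ∂μ) :
    HasFDerivAt (fun a : Lp ℝ (ENNReal.ofReal lam) μ =>
      mulForm μ lam ι (fun x => φ (a x) (b x))) T' a := by
  set k := Fintype.card ι with hkdef
  have hk0 : (k : ℝ) < lam := lt_trans (by simp) hk
  have hmem := hφ.memLp hk0 (μ := μ)
  have hmem' := hφ'.memLp hk (μ := μ)
  have hm : 0 < lam - (k + 1 : ℕ) := sub_pos.2 hk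
  have : ENNReal.HolderTriple (coExp lam (k + 1)) (ENNReal.ofReal lam) (coExp lam k) :=
    ⟨by simpa using inv_coExp_add (l := k) (k := 1) hlam hk⟩
  set S : ℝ × ℝ × ℝ → ℝ := fun z => ∫ t in (0 : ℝ)..1, φ' (z.1 + t * z.2.2) z.2.1 with hS
  obtain ⟨hSc, C, hC⟩ : PolyGrowth (lam - (k + 1 : ℕ)) S := hφ'.intervalIntegral hm.le
  set G : Lp ℝ (ENNReal.ofReal lam) μ → X → ℝ :=
    fun d x => S (a x, b x, d x) - φ' (a x) (b x) with hG
  have hGmem (d) : MemLp (G d) (coExp lam (k + 1)) μ := by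
    refine MemLp.sub ?_ (hmem' a b)
    refine (memLp_comp_of_growth hm hSc hC (Lp.memLp (pairLp a (pairLp b d)))).ae_eq ?_
    filter_upwards [coeFn_pairLp a (pairLp b d), coeFn_pairLp b d] with x h1 h2
    rw [h1, h2]
  have hGlim : Tendsto (fun d => (eLpNorm (G d) (coExp lam (k + 1)) μ).toReal) (𝓝 0) (𝓝 0) := by
    rw [← ENNReal.toReal_zero]
    refine (ENNReal.tendsto_toReal ENNReal.zero_ne_top).comp ?_
    have h1 := tendsto_eLpNorm_comp₂_sub hm (sub_le_self _ (Nat.cast_nonneg _)) hSc hC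
      (a, pairLp b (0 : Lp ℝ (ENNReal.ofReal lam) μ))
    have h2 : Continuous fun d : Lp ℝ (ENNReal.ofReal lam) μ => (a, pairLp b d) :=
      continuous_const.prodMk (continuous_pairLp.comp (continuous_const.prodMk continuous_id))
    refine (h1.comp (h2.tendsto 0)).congr fun d => eLpNorm_congr_ae ?_
    filter_upwards [coeFn_pairLp b d, coeFn_pairLp b (0 : Lp ℝ (ENNReal.ofReal lam) μ),
      Lp.coeFn_zero ℝ (ENNReal.ofReal lam) μ] with x h1 h2 h3
    rw [Pi.zero_apply] at h3
    simp only [h1, h2, h3, hG, hS, mul_zero, add_zero,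
      intervalIntegral.integral_const, sub_zero, one_smul]
  have hGd (d : Lp ℝ (ENNReal.ofReal lam) μ) : MemLp (fun x => G d x * d x) (coExp lam k) μ :=
    (Lp.memLp d).mul' (hGmem d)
  have hbound (d : Lp ℝ (ENNReal.ofReal lam) μ) :
      ‖mulForm μ lam ι (fun x => φ ((a + d : Lp ℝ (ENNReal.ofReal lam) μ) x) (b x)) -
        mulForm μ lam ι (fun x => φ (a x) (b x)) - T' d‖ ≤
        (eLpNorm (G d) (coExp lam (k + 1)) μ).toReal * ‖d‖ := by
    refine ContinuousMultilinearMap.opNorm_le_bound (by positivity) fun h => ?_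
    have hint : Integrable (fun x => φ' (a x) (b x) * (d x * ∏ i, h i x)) μ := by
      simp only [← mul_assoc]
      exact integrable_mul_prod_Lp hlam hk0 ((Lp.memLp d).mul' (hmem' a b)) h
    have heq : (mulForm μ lam ι (fun x => φ ((a + d : Lp ℝ (ENNReal.ofReal lam) μ) x) (b x)) -
        mulForm μ lam ι (fun x => φ (a x) (b x)) - T' d) h =
        ∫ x, (G d x * d x) * ∏ i, h i x ∂μ := by
      have i1 := integrable_mul_prod_Lp hlam hk0 (hmem (a + d) b) h
      have i2 := integrable_mul_prod_Lp hlam hk0 (hmem a b) h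
      rw [sub_apply, sub_apply, mulForm_apply hlam hk0 (hmem _ _),
        mulForm_apply hlam hk0 (hmem _ _), hT', ← integral_sub i1 i2]
      refine (integral_sub (i1.sub i2) hint).symm.trans (integral_congr_ae ?_)
      filter_upwards [Lp.coeFn_add a d] with x hx
      have := integral_segment_mul hφ'.1 hd (a x) (b x) (d x)
      rw [Pi.sub_apply, hx, Pi.add_apply, ← sub_mul, this]
      simp only [hG, hS]
      ring
    rw [heq]
    refine (abs_integral_mul_prod_Lp_le hlam hk0 (hGd d) h).trans ?_
    gcongr
    rw [Lp.norm_def, ← ENNReal.toReal_mul]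
    exact ENNReal.toReal_mono (ENNReal.mul_lt_top (hGmem d).2 (Lp.eLpNorm_lt_top d)).ne
      (eLpNorm_smul_le_mul_eLpNorm (φ := G d) (f := d) (Lp.aestronglyMeasurable d) (hGmem d).1)
  rw [hasFDerivAt_iff_isLittleO_nhds_zero, Asymptotics.isLittleO_iff]
  intro c hc
  filter_upwards [hGlim.eventually (ge_mem_nhds hc)] with d hd'
  exact (hbound d).trans (by gcongr)

end Derivative

theorem LinearIsometryEquiv.hasFDerivAt_comp_of_eq {E F G : Type*}
    [NormedAddCommGroup E] [NormedSpace ℝ E] [NormedAddCommGroup F] [NormedSpace ℝ F]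
    [NormedAddCommGroup G] [NormedSpace ℝ G] (e : F ≃ₗᵢ[ℝ] G) {f : E → F} {f' : E →L[ℝ] F} {x : E}
    (hf : HasFDerivAt f f' x) {g' : E →L[ℝ] G} (hg : ∀ d, g' d = e (f' d)) :
    HasFDerivAt (fun y => e (f y)) g' x := by
  have := e.toContinuousLinearEquiv.hasFDerivAt.comp x hf
  have hg' : g' = (e.toContinuousLinearEquiv : F →L[ℝ] G).comp f' := ContinuousLinearMap.ext hg
  rwa [hg']

section Partial

variable {X : Type*} [MeasurableSpace X] {μ : Measure X} [IsFiniteMeasure μ] {lam : ℝ}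
  [Fact (1 ≤ ENNReal.ofReal lam)]

/-- A family of mixed partial derivatives `F i j = ∂₁^i ∂₂^j F` whose growth is compatible with
integration against `i + j` factors in `L^lam`. -/
structure IsJetFamily (lam : ℝ) (F : ℕ → ℕ → ℝ → ℝ → ℝ) : Prop where
  deriv_fst : ∀ i j x y, HasDerivAt (fun s => F i j s y) (F (i + 1) j x y) x
  deriv_snd : ∀ i j x y, HasDerivAt (fun s => F i j x s) (F i (j + 1) x y) y
  growth : ∀ i j : ℕ, (i : ℝ) + 1 ≤ lam → (j : ℝ) + 1 ≤ lam → ((i + j : ℕ) : ℝ) < lam →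
    PolyGrowth (lam - (i + j : ℕ)) (fun z : ℝ × ℝ => F i j z.1 z.2)

namespace IsJetFamily

variable {F : ℕ → ℕ → ℝ → ℝ → ℝ}

theorem hasFTaylorSeriesUpTo_fst (hF : IsJetFamily lam F) {i : ℕ} (hi : (i : ℝ) + 1 ≤ lam)
    (b : Lp ℝ (ENNReal.ofReal lam) μ) :
    HasFTaylorSeriesUpTo i (fun a : Lp ℝ (ENNReal.ofReal lam) μ => ∫ x, F 0 0 (a x) (b x) ∂μ)
      (fun a m => mulForm μ lam (Fin m) (fun x => F m 0 (a x) (b x))) := by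
  have h1lam : (1 : ℝ) ≤ lam := le_trans (by simp) hi
  have hlam : 0 < lam := by linarith
  have hgr {m : ℕ} (hm : m ≤ i) :
      PolyGrowth (lam - (m : ℕ)) (fun z : ℝ × ℝ => F m 0 z.1 z.2) := by
    have : (m : ℝ) ≤ i := by exact_mod_cast hm
    exact hF.growth m 0 (by linarith) (by simpa using h1lam) (by push_cast; linarith)
  have hlt {m : ℕ} (hm : m ≤ i) : (m : ℝ) < lam := by
    have : (m : ℝ) ≤ i := by exact_mod_cast hm
    linarith
  refine ⟨fun a => ?_, fun m hm a => ?_, fun m hm => ?_⟩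
  · rw [ContinuousMultilinearMap.curry0, mulForm_apply hlam (by simpa using hlam)]
    · simp
    · simpa using (hgr (Nat.zero_le i)).memLp (hlt (Nat.zero_le i)) a b
  · have hm' : m + 1 ≤ i := by exact_mod_cast hm
    refine hasFDerivAt_mulForm hlam (φ := F m 0) (φ' := F (m + 1) 0) ?_ ?_ ?_
      (fun x y => hF.deriv_fst m 0 x y) a b fun d h => ?_
    · simpa using hlt hm'
    · simpa using hgr (Nat.le_of_succ_le hm')
    · simpa using hgr hm'
    · rw [ContinuousMultilinearMap.curryLeft_apply, mulForm_apply hlam]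
      · simp [Fin.prod_univ_succ]
      · simpa using hlt hm'
      · simpa using (hgr hm').memLp (hlt hm') a b
  · have hm' : m ≤ i := by exact_mod_cast hm
    exact (continuous_mulForm hlam (φ := F m 0) (by simpa using hlt hm')
      (by simpa using hgr hm')).comp (continuous_id.prodMk continuous_const)

theorem iteratedFDeriv_fst (hF : IsJetFamily lam F) {i : ℕ} (hi : (i : ℝ) + 1 ≤ lam)
    (a b : Lp ℝ (ENNReal.ofReal lam) μ) :
    iteratedFDeriv ℝ i (fun a : Lp ℝ (ENNReal.ofReal lam) μ => ∫ x, F 0 0 (a x) (b x) ∂μ) a =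
      mulForm μ lam (Fin i) (fun x => F i 0 (a x) (b x)) :=
  ((hF.hasFTaylorSeriesUpTo_fst hi b).eq_iteratedFDeriv le_rfl a).symm

theorem hasFTaylorSeriesUpTo_snd (hF : IsJetFamily lam F) {i j : ℕ} (hi : (i : ℝ) + 1 ≤ lam)
    (hj : (j : ℝ) + 1 ≤ lam) (hij : ((i + j : ℕ) : ℝ) < lam)
    (a : Lp ℝ (ENNReal.ofReal lam) μ) :
    HasFTaylorSeriesUpTo j
      (fun b : Lp ℝ (ENNReal.ofReal lam) μ => iteratedFDeriv ℝ i
        (fun a : Lp ℝ (ENNReal.ofReal lam) μ => ∫ x, F 0 0 (a x) (b x) ∂μ) a)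
      (fun b m => (mulForm μ lam (Fin m ⊕ Fin i) (fun x => F i m (a x) (b x))).currySum) := by
  have h1lam : (1 : ℝ) ≤ lam := le_trans (by simp) hi
  have hlam : 0 < lam := by linarith
  have hlt {m : ℕ} (hm : m ≤ j) : ((i + m : ℕ) : ℝ) < lam :=
    lt_of_le_of_lt (by exact_mod_cast Nat.add_le_add_left hm i) hij
  have hgr {m : ℕ} (hm : m ≤ j) :
      PolyGrowth (lam - (i + m : ℕ)) (fun z : ℝ × ℝ => F i m z.1 z.2) := by
    have : (m : ℝ) ≤ j := by exact_mod_cast hm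
    exact hF.growth i m hi (by linarith) (hlt hm)
  have hcard (m : ℕ) : Fintype.card (Fin m ⊕ Fin i) = i + m := by simp [add_comm]
  refine ⟨fun b => ?_, fun m hm b => ?_, fun m hm => ?_⟩
  · rw [hF.iteratedFDeriv_fst hi a b]
    have h0 := (hgr (Nat.zero_le j)).memLp (hlt (Nat.zero_le j)) a b
    ext h
    rw [ContinuousMultilinearMap.curry0, ContinuousMultilinearMap.currySum_apply,
      mulForm_apply hlam (by rw [hcard]; exact hlt (Nat.zero_le j)) (by rw [hcard]; exact h0),
      mulForm_apply hlam (by simpa using hlt (Nat.zero_le j)) (by simpa using h0)]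
    simp
  · have hm' : m + 1 ≤ j := by exact_mod_cast hm
    have hcard' : Fintype.card (Fin m ⊕ Fin i) + 1 = i + (m + 1) := by rw [hcard, add_assoc]
    let e := ContinuousMultilinearMap.currySumEquiv ℝ (Fin m) (Fin i)
      (Lp ℝ (ENNReal.ofReal lam) μ) ℝ
    let T := (mulForm μ lam (Fin (m + 1) ⊕ Fin i)
      (fun x => F i (m + 1) (a x) (b x))).currySum.curryLeft
    have key := hasFDerivAt_mulForm (ι := Fin m ⊕ Fin i) (φ := fun y x => F i m x y)
      (φ' := fun y x => F i (m + 1) x y) hlam (by rw [hcard']; exact hlt hm')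
      (by rw [hcard]; exact (hgr (Nat.le_of_succ_le hm')).comp_swap)
      (by rw [hcard']; exact (hgr hm').comp_swap)
      (fun y x => hF.deriv_snd i m x y) b a
      (T' := (e.symm.toContinuousLinearEquiv : _ →L[ℝ] _).comp T) fun d h => ?_
    · exact e.hasFDerivAt_comp_of_eq key (g' := T) fun d => (e.apply_symm_apply (T d)).symm
    · change mulForm μ lam (Fin (m + 1) ⊕ Fin i) (fun x => F i (m + 1) (a x) (b x))
        (Sum.elim (Fin.cons d (h ∘ Sum.inl)) (h ∘ Sum.inr)) = _
      rw [mulForm_apply hlam (by rw [hcard]; exact hlt hm')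
        (by rw [hcard]; exact (hgr hm').memLp (hlt hm') a b)]
      simp [Fin.prod_univ_succ, mul_assoc]
  · have hm' : m ≤ j := by exact_mod_cast hm
    exact (ContinuousMultilinearMap.currySumEquiv ℝ (Fin m) (Fin i)
      (Lp ℝ (ENNReal.ofReal lam) μ) ℝ).continuous.comp
        ((continuous_mulForm hlam (φ := F i m) (by rw [hcard]; exact hlt hm')
          (by rw [hcard]; exact hgr hm')).comp (continuous_const.prodMk continuous_id))

theorem continuous_iteratedFDeriv (hF : IsJetFamily lam F) {i j : ℕ} (hi : (i : ℝ) + 1 ≤ lam)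
    (hj : (j : ℝ) + 1 ≤ lam) (hij : ((i + j : ℕ) : ℝ) < lam) :
    Continuous fun q : Lp ℝ (ENNReal.ofReal lam) μ × Lp ℝ (ENNReal.ofReal lam) μ =>
      iteratedFDeriv ℝ j (fun b : Lp ℝ (ENNReal.ofReal lam) μ => iteratedFDeriv ℝ i
        (fun a : Lp ℝ (ENNReal.ofReal lam) μ => ∫ x, F 0 0 (a x) (b x) ∂μ) q.1) q.2 := by
  have hlam : 0 < lam := lt_of_lt_of_le (by positivity) hi
  have hcard : Fintype.card (Fin j ⊕ Fin i) = i + j := by simp [add_comm]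
  simp only [fun q : Lp ℝ (ENNReal.ofReal lam) μ × Lp ℝ (ENNReal.ofReal lam) μ =>
    ((hF.hasFTaylorSeriesUpTo_snd hi hj hij q.1).eq_iteratedFDeriv le_rfl q.2).symm]
  exact (ContinuousMultilinearMap.currySumEquiv ℝ (Fin j) (Fin i)
    (Lp ℝ (ENNReal.ofReal lam) μ) ℝ).continuous.comp
      (continuous_mulForm hlam (φ := F i j) (by rw [hcard]; exact hij)
        (by rw [hcard]; exact hF.growth i j hi hj hij))

end IsJetFamily

end Partial

section Symbols

namespace PolyGrowth

variable {E F : Type*} [NormedAddCommGroup E] [NormedAddCommGroup F] {m n : ℝ} {Φ Ψ : E → ℝ}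

theorem mono (h : PolyGrowth m Φ) (hmn : m ≤ n) : PolyGrowth n Φ := by
  obtain ⟨hc, C, hC⟩ := h
  have hC0 := nonneg_of_bound hC
  refine ⟨hc, C, fun z => (hC z).trans ?_⟩
  gcongr
  simp

theorem zero : PolyGrowth m (fun _ : E => (0 : ℝ)) :=
  ⟨continuous_const, 0, by simp⟩

theorem add (h : PolyGrowth m Φ) (h' : PolyGrowth m Ψ) : PolyGrowth m (fun z => Φ z + Ψ z) := by
  obtain ⟨hc, C, hC⟩ := h
  obtain ⟨hc', C', hC'⟩ := h'
  refine ⟨hc.add hc', C + C', fun z => (abs_add_le _ _).trans ?_⟩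
  rw [add_mul]
  exact add_le_add (hC z) (hC' z)

theorem mul (h : PolyGrowth m Φ) (h' : PolyGrowth n Ψ) :
    PolyGrowth (m + n) (fun z => Φ z * Ψ z) := by
  obtain ⟨hc, C, hC⟩ := h
  obtain ⟨hc', C', hC'⟩ := h'
  have hC0 := nonneg_of_bound hC
  refine ⟨hc.mul hc', C * C', fun z => ?_⟩
  rw [abs_mul, Real.rpow_add (by positivity), mul_mul_mul_comm]
  gcongr
  exacts [hC z, hC' z]

theorem const_mul (h : PolyGrowth m Φ) (c : ℝ) : PolyGrowth m (fun z => c * Φ z) := by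
  obtain ⟨hc, C, hC⟩ := h
  refine ⟨continuous_const.mul hc, |c| * C, fun z => ?_⟩
  rw [abs_mul, mul_assoc]
  gcongr
  exact hC z

theorem comp_fst (hm : 0 ≤ m) (h : PolyGrowth m Φ) : PolyGrowth m (fun z : E × F => Φ z.1) := by
  obtain ⟨hc, C, hC⟩ := h
  have hC0 := nonneg_of_bound hC
  refine ⟨hc.comp continuous_fst, C, fun z => (hC z.1).trans ?_⟩
  gcongr
  exact norm_fst_le z

theorem comp_snd (hm : 0 ≤ m) (h : PolyGrowth m Φ) : PolyGrowth m (fun z : F × E => Φ z.2) := by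
  obtain ⟨hc, C, hC⟩ := h
  have hC0 := nonneg_of_bound hC
  refine ⟨hc.comp continuous_snd, C, fun z => (hC z.2).trans ?_⟩
  gcongr
  exact norm_snd_le z

end PolyGrowth

/-- A smooth function of growth order `m` all of whose derivatives have growth order `n`. -/
structure IsSymbol (m n : ℝ) (f : ℝ → ℝ) : Prop where
  contDiff : ContDiff ℝ (⊤ : ℕ∞) f
  growth : PolyGrowth m f
  growth_deriv : ∀ k, PolyGrowth n (iteratedDeriv (k + 1) f)

namespace IsSymbol

variable {m n : ℝ} {f g : ℝ → ℝ}

theorem mono {m' n' : ℝ} (h : IsSymbol m n f) (hm : m ≤ m') (hn : n ≤ n') : IsSymbol m' n' f :=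
  ⟨h.1, h.2.mono hm, fun k => (h.3 k).mono hn⟩

theorem add (hf : IsSymbol m n f) (hg : IsSymbol m n g) : IsSymbol m n (fun x => f x + g x) := by
  refine ⟨hf.1.add hg.1, hf.2.add hg.2, fun k => ?_⟩
  have : iteratedDeriv (k + 1) (fun x => f x + g x) =
      fun x => iteratedDeriv (k + 1) f x + iteratedDeriv (k + 1) g x := by
    ext x
    exact iteratedDeriv_fun_add (hf.1.of_le (mod_cast le_top)).contDiffAt
      (hg.1.of_le (mod_cast le_top)).contDiffAt
  rw [this]
  exact (hf.3 k).add (hg.3 k)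

theorem const_mul (hf : IsSymbol m n f) (c : ℝ) : IsSymbol m n (fun x => c * f x) := by
  refine ⟨contDiff_const.mul hf.1, hf.2.const_mul c, fun k => ?_⟩
  have : iteratedDeriv (k + 1) (fun x => c * f x) =
      fun x => c * iteratedDeriv (k + 1) f x := by
    ext x
    exact iteratedDeriv_const_mul_field c f
  rw [this]
  exact (hf.3 k).const_mul c

theorem hasDerivAt_iteratedDeriv (hf : IsSymbol m n f) (k : ℕ) (x : ℝ) :
    HasDerivAt (iteratedDeriv k f) (iteratedDeriv (k + 1) f x) x := by
  rw [iteratedDeriv_succ]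
  exact (hf.1.differentiable_iteratedDeriv k
    (mod_cast ENat.natCast_lt_top k)).differentiableAt.hasDerivAt

/-- A function is a symbol if its derivative lies in a class closed under differentiation whose
members have growth order `n`. -/
theorem of_deriv_mem {S : Set (ℝ → ℝ)}
    (hS : ∀ u ∈ S, ∃ v ∈ S, ∀ x, HasDerivAt u (v x) x) (hSn : ∀ u ∈ S, PolyGrowth n u)
    (hfm : PolyGrowth m f) (hg : g ∈ S) (hfg : ∀ x, HasDerivAt f (g x) x) : IsSymbol m n f := by
  have hmem (k : ℕ) : iteratedDeriv (k + 1) f ∈ S := by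
    induction k with
    | zero =>
      rw [iteratedDeriv_one]
      exact (funext fun x => (hfg x).deriv : deriv f = g) ▸ hg
    | succ k ih =>
      obtain ⟨v, hv, hd⟩ := hS _ ih
      rw [iteratedDeriv_succ]
      exact (funext fun x => (hd x).deriv : deriv _ = v) ▸ hv
  refine ⟨contDiff_of_differentiable_iteratedDeriv fun k _ => ?_, hfm, fun k => hSn _ (hmem k)⟩
  cases k with
  | zero =>
    rw [iteratedDeriv_zero]
    exact fun x => (hfg x).differentiableAt
  | succ k =>
    obtain ⟨v, -, hd⟩ := hS _ (hmem k)
    exact fun x => (hd x).differentiableAt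

end IsSymbol

theorem isJetFamily_of_isSymbol {lam : ℝ} (hlam : 2 ≤ lam) {A B f g : ℝ → ℝ}
    (hA : IsSymbol 2 1 A) (hB : IsSymbol 2 1 B) (hf : IsSymbol 1 0 f) (hg : IsSymbol 1 0 g) :
    IsJetFamily lam (fun i j x y => (if j = 0 then iteratedDeriv i A x else 0) +
      (if i = 0 then iteratedDeriv j B y else 0) + iteratedDeriv i f x * iteratedDeriv j g y) := by
  refine ⟨fun i j x y => ?_, fun i j x y => ?_, fun i j hi hj hij => ?_⟩
  · refine HasDerivAt.add ?_ ((hf.hasDerivAt_iteratedDeriv i x).mul_const _)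
    rw [if_neg i.succ_ne_zero]
    refine HasDerivAt.add ?_ (hasDerivAt_const _ _)
    split_ifs
    exacts [hA.hasDerivAt_iteratedDeriv i x, hasDerivAt_const _ _]
  · refine HasDerivAt.add ?_ ((hg.hasDerivAt_iteratedDeriv j y).const_mul _)
    rw [if_neg j.succ_ne_zero]
    refine HasDerivAt.add (hasDerivAt_const _ _) ?_
    split_ifs
    exacts [hB.hasDerivAt_iteratedDeriv j y, hasDerivAt_const _ _]
  · push_cast at hij ⊢
    refine PolyGrowth.add (PolyGrowth.add ?_ ?_) ?_
    · split_ifs with h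
      · subst h
        rcases i with _ | i
        · simp only [iteratedDeriv_zero]
          exact (hA.2.comp_fst (by norm_num)).mono (by simpa using hlam)
        · exact ((hA.3 i).comp_fst (by norm_num)).mono (by push_cast at hi ⊢; linarith)
      · exact PolyGrowth.zero
    · split_ifs with h
      · subst h
        rcases j with _ | j
        · simp only [iteratedDeriv_zero]
          exact (hB.2.comp_snd (by norm_num)).mono (by simpa using hlam)
        · exact ((hB.3 j).comp_snd (by norm_num)).mono (by push_cast at hj ⊢; linarith)
      · exact PolyGrowth.zero
    · rcases i with _ | i <;> rcases j with _ | j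
      · simp only [iteratedDeriv_zero]
        exact ((hf.2.comp_fst (by norm_num)).mul (hg.2.comp_snd (by norm_num))).mono
          (by push_cast; linarith)
      · simp only [iteratedDeriv_zero]
        exact ((hf.2.comp_fst (by norm_num)).mul ((hg.3 j).comp_snd (by norm_num))).mono
          (by push_cast at hj ⊢; linarith)
      · simp only [iteratedDeriv_zero]
        exact (((hf.3 i).comp_fst (by norm_num)).mul (hg.2.comp_snd (by norm_num))).mono
          (by push_cast at hi ⊢; linarith)
      · exact (((hf.3 i).comp_fst (by norm_num)).mul ((hg.3 j).comp_snd (by norm_num))).mono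
          (by push_cast at hij ⊢; linarith)

end Symbols

section DeformedExponential

variable {ψ : ℝ → ℝ}

theorem strictMono_of_add_log_eq
    (hψ : ∀ z : ℝ, 0 < ψ z ∧ ψ z + Real.log (ψ z) = z) : StrictMono ψ := by
  refine fun x y hxy => lt_of_not_ge fun h => ?_
  have := Real.log_le_log (hψ y).1 h
  linarith [(hψ x).2, (hψ y).2]

theorem continuous_of_add_log_eq
    (hψ : ∀ z : ℝ, 0 < ψ z ∧ ψ z + Real.log (ψ z) = z) : Continuous ψ := by
  have h (x y : ℝ) (hxy : x ≤ y) : |ψ y - ψ x| ≤ |y - x| := by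
    have h1 := (strictMono_of_add_log_eq hψ).monotone hxy
    have := Real.log_le_log (hψ x).1 h1
    rw [abs_of_nonneg (by linarith), abs_of_nonneg (by linarith)]
    linarith [(hψ x).2, (hψ y).2]
  refine (LipschitzWith.of_dist_le_mul (K := 1) fun x y => ?_).continuous
  rw [NNReal.coe_one, one_mul, Real.dist_eq, Real.dist_eq]
  rcases le_total x y with hxy | hxy
  · rw [abs_sub_comm, abs_sub_comm x]
    exact h x y hxy
  · exact h y x hxy

theorem hasDerivAt_of_add_log_eq
    (hψ : ∀ z : ℝ, 0 < ψ z ∧ ψ z + Real.log (ψ z) = z)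
    (x : ℝ) : HasDerivAt ψ (ψ x * (1 + ψ x)⁻¹) x := by
  have h0 := (hψ x).1
  have h1 : HasDerivAt (fun y => y + Real.log y) (1 + (ψ x)⁻¹) (ψ x) :=
    (hasDerivAt_id _).add (Real.hasDerivAt_log h0.ne')
  refine (h1.of_local_left_inverse (continuous_of_add_log_eq hψ).continuousAt (by positivity)
    (Eventually.of_forall fun y => (hψ y).2)).congr_deriv ?_
  field_simp
  ring

theorem hasDerivAt_inv_one_add
    (hψ : ∀ z : ℝ, 0 < ψ z ∧ ψ z + Real.log (ψ z) = z) (x : ℝ) :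
    HasDerivAt (fun x => (1 + ψ x)⁻¹) (-(1 - (1 + ψ x)⁻¹) * (1 + ψ x)⁻¹ ^ 2) x := by
  have h0 := (hψ x).1
  have h1 : 1 + ψ x ≠ 0 := by positivity
  refine (((hasDerivAt_of_add_log_eq hψ x).const_add 1).inv h1).congr_deriv ?_
  field_simp
  ring

theorem hasDerivAt_rpow_of_add_log_eq
    (hψ : ∀ z : ℝ, 0 < ψ z ∧ ψ z + Real.log (ψ z) = z) (s x : ℝ) :
    HasDerivAt (fun x => ψ x ^ s) (s * (ψ x ^ s * (1 + ψ x)⁻¹)) x := by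
  have h0 := (hψ x).1
  refine ((hasDerivAt_of_add_log_eq hψ x).rpow_const (p := s) (Or.inl h0.ne')).congr_deriv ?_
  rw [Real.rpow_sub_one h0.ne']
  have h1 := mul_div_cancel₀ (ψ x ^ s) h0.ne'
  linear_combination s * (1 + ψ x)⁻¹ * h1

theorem hasDerivAt_log_of_add_log_eq
    (hψ : ∀ z : ℝ, 0 < ψ z ∧ ψ z + Real.log (ψ z) = z) (x : ℝ) :
    HasDerivAt (fun x => Real.log (ψ x)) ((1 + ψ x)⁻¹) x := by
  have h0 := (hψ x).1
  refine ((hasDerivAt_of_add_log_eq hψ x).log h0.ne').congr_deriv ?_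
  rw [mul_div_cancel_left₀ _ h0.ne']

theorem polyGrowth_of_add_log_eq
    (hψ : ∀ z : ℝ, 0 < ψ z ∧ ψ z + Real.log (ψ z) = z) : PolyGrowth 1 ψ := by
  refine ⟨continuous_of_add_log_eq hψ, 1, fun x => ?_⟩
  obtain ⟨h0, h1⟩ := hψ x
  rw [Real.rpow_one, one_mul, abs_of_pos h0, Real.norm_eq_abs]
  rcases le_total (ψ x) 1 with h | h
  · linarith [abs_nonneg x]
  · linarith [Real.log_nonneg h, le_abs_self x]

theorem polyGrowth_log_of_add_log_eq
    (hψ : ∀ z : ℝ, 0 < ψ z ∧ ψ z + Real.log (ψ z) = z) :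
    PolyGrowth 1 (fun x => Real.log (ψ x)) := by
  refine ⟨continuous_iff_continuousAt.2
    fun x => (hasDerivAt_log_of_add_log_eq hψ x).continuousAt, ?_⟩
  obtain ⟨-, C, hC⟩ := polyGrowth_of_add_log_eq hψ
  refine ⟨1 + C, fun x => ?_⟩
  have h1 : Real.log (ψ x) = x - ψ x := by linarith [(hψ x).2]
  have h2 := abs_sub x (ψ x)
  have h3 := hC x
  rw [Real.rpow_one, Real.norm_eq_abs] at h3 ⊢
  simp only [h1]
  linarith

theorem rpow_le_one_add
    (hψ : ∀ z : ℝ, 0 < ψ z ∧ ψ z + Real.log (ψ z) = z)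
    {s : ℝ} (hs : s ∈ Icc (0 : ℝ) 1) (x : ℝ) : ψ x ^ s ≤ 1 + ψ x := by
  have h0 := (hψ x).1
  rcases le_total (ψ x) 1 with h | h
  · linarith [Real.rpow_le_one h0.le h hs.1]
  · linarith [(Real.rpow_le_rpow_of_exponent_le h hs.2).trans_eq (Real.rpow_one _)]

theorem polyGrowth_rpow_of_add_log_eq
    (hψ : ∀ z : ℝ, 0 < ψ z ∧ ψ z + Real.log (ψ z) = z) {s : ℝ} (hs : s ∈ Icc (0 : ℝ) 1) :
    PolyGrowth 1 (fun x => ψ x ^ s) := by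
  refine ⟨continuous_iff_continuousAt.2
    fun x => (hasDerivAt_rpow_of_add_log_eq hψ s x).continuousAt, ?_⟩
  obtain ⟨-, C, hC⟩ := polyGrowth_of_add_log_eq hψ
  refine ⟨1 + C, fun x => ?_⟩
  have h0 := (hψ x).1
  have h2 := rpow_le_one_add hψ hs x
  have h3 := hC x
  rw [Real.rpow_one, Real.norm_eq_abs] at h3 ⊢
  rw [abs_of_nonneg (by positivity)]
  rw [abs_of_pos h0] at h3
  linarith [abs_nonneg x]

open Polynomial in
theorem hasDerivAt_rpow_mul_eval
    (hψ : ∀ z : ℝ, 0 < ψ z ∧ ψ z + Real.log (ψ z) = z) (s : ℝ) (P : ℝ[X]) (x : ℝ) :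
    HasDerivAt (fun x => ψ x ^ s * (1 + ψ x)⁻¹ * P.eval (1 + ψ x)⁻¹)
      (ψ x ^ s * (1 + ψ x)⁻¹ * (C s * X * P - (1 - X) * X * P
        - (1 - X) * X ^ 2 * derivative P).eval (1 + ψ x)⁻¹) x := by
  have hσ := hasDerivAt_inv_one_add hψ x
  refine (((hasDerivAt_rpow_of_add_log_eq hψ s x).mul hσ).mul
    ((P.hasDerivAt (1 + ψ x)⁻¹).comp x hσ)).congr_deriv ?_
  simp only [eval_sub, eval_mul, eval_C, eval_X, eval_one, eval_pow, Function.comp_apply,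
    Pi.mul_apply]
  ring

theorem polyGrowth_rpow_mul_eval
    (hψ : ∀ z : ℝ, 0 < ψ z ∧ ψ z + Real.log (ψ z) = z)
    {s : ℝ} (hs : s ∈ Icc (0 : ℝ) 1) (P : Polynomial ℝ) :
    PolyGrowth 0 (fun x => ψ x ^ s * (1 + ψ x)⁻¹ * P.eval (1 + ψ x)⁻¹) := by
  refine ⟨continuous_iff_continuousAt.2
    fun x => (hasDerivAt_rpow_mul_eval hψ s P x).continuousAt, ?_⟩
  obtain ⟨C, hC⟩ := (isCompact_Icc (a := (0 : ℝ)) (b := 1)).exists_bound_of_continuousOn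
    P.continuous.continuousOn
  refine ⟨C, fun x => ?_⟩
  have h0 := (hψ x).1
  have h1 := hC (1 + ψ x)⁻¹ ⟨by positivity, inv_le_one_of_one_le₀ (by linarith)⟩
  have h2 : ψ x ^ s * (1 + ψ x)⁻¹ ≤ 1 :=
    mul_inv_le_one_of_le₀ (rpow_le_one_add hψ hs x) (by positivity)
  rw [Real.rpow_zero, mul_one, abs_mul, abs_of_nonneg (by positivity)]
  exact (mul_le_of_le_one_left (abs_nonneg _) h2).trans h1

theorem isSymbol_of_hasDerivAt_rpow_mul_eval
    (hψ : ∀ z : ℝ, 0 < ψ z ∧ ψ z + Real.log (ψ z) = z)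
    {s m : ℝ} (hs : s ∈ Icc (0 : ℝ) 1) {f : ℝ → ℝ}
    (hf : PolyGrowth m f) (P : Polynomial ℝ)
    (hd : ∀ x, HasDerivAt f (ψ x ^ s * (1 + ψ x)⁻¹ * P.eval (1 + ψ x)⁻¹) x) :
    IsSymbol m 0 f := by
  refine IsSymbol.of_deriv_mem (S := range fun (P : Polynomial ℝ) (x : ℝ) =>
    ψ x ^ s * (1 + ψ x)⁻¹ * P.eval (1 + ψ x)⁻¹) ?_ ?_ hf ⟨P, rfl⟩ hd
  · rintro _ ⟨P, rfl⟩
    exact ⟨_, ⟨_, rfl⟩, hasDerivAt_rpow_mul_eval hψ s P⟩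
  · rintro _ ⟨P, rfl⟩
    exact polyGrowth_rpow_mul_eval hψ hs P

theorem isSymbol_rpow
    (hψ : ∀ z : ℝ, 0 < ψ z ∧ ψ z + Real.log (ψ z) = z)
    {s : ℝ} (hs : s ∈ Icc (0 : ℝ) 1) : IsSymbol 1 0 (fun x => ψ x ^ s) := by
  refine isSymbol_of_hasDerivAt_rpow_mul_eval hψ hs (polyGrowth_rpow_of_add_log_eq hψ hs)
    (Polynomial.C s) fun x => ?_
  refine (hasDerivAt_rpow_of_add_log_eq hψ s x).congr_deriv ?_
  rw [Polynomial.eval_C]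
  ring

theorem isSymbol_of_add_log_eq
    (hψ : ∀ z : ℝ, 0 < ψ z ∧ ψ z + Real.log (ψ z) = z) : IsSymbol 1 0 ψ := by
  simpa using isSymbol_rpow hψ (s := 1) (by simp)

theorem isSymbol_log
    (hψ : ∀ z : ℝ, 0 < ψ z ∧ ψ z + Real.log (ψ z) = z) :
    IsSymbol 1 0 (fun x => Real.log (ψ x)) := by
  refine isSymbol_of_hasDerivAt_rpow_mul_eval hψ (s := 0) (by simp)
    (polyGrowth_log_of_add_log_eq hψ) 1 fun x => ?_
  simpa using hasDerivAt_log_of_add_log_eq hψ x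

open Polynomial in
theorem isSymbol_mul_log
    (hψ : ∀ z : ℝ, 0 < ψ z ∧ ψ z + Real.log (ψ z) = z) :
    IsSymbol 2 1 (fun x => ψ x * Real.log (ψ x)) := by
  have h1 : (1 : ℝ) ∈ Icc (0 : ℝ) 1 := by simp
  refine IsSymbol.of_deriv_mem (S := range fun (P : Polynomial ℝ × Polynomial ℝ) (x : ℝ) =>
    ψ x ^ (1 : ℝ) * (1 + ψ x)⁻¹ * P.1.eval (1 + ψ x)⁻¹ * Real.log (ψ x) +
      ψ x ^ (1 : ℝ) * (1 + ψ x)⁻¹ * P.2.eval (1 + ψ x)⁻¹) ?_ ?_ ?_ ⟨(1, 1), rfl⟩ fun x => ?_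
  · rintro _ ⟨P, rfl⟩
    refine ⟨_, ⟨(C 1 * X * P.1 - (1 - X) * X * P.1 - (1 - X) * X ^ 2 * derivative P.1,
      X * P.1 + (C 1 * X * P.2 - (1 - X) * X * P.2 - (1 - X) * X ^ 2 * derivative P.2)), rfl⟩,
      fun x => ?_⟩
    refine (((hasDerivAt_rpow_mul_eval hψ 1 P.1 x).mul (hasDerivAt_log_of_add_log_eq hψ x)).add
      (hasDerivAt_rpow_mul_eval hψ 1 P.2 x)).congr_deriv ?_
    simp only [eval_add, eval_mul, eval_X]
    ring
  · rintro _ ⟨P, rfl⟩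
    exact (((polyGrowth_rpow_mul_eval hψ h1 P.1).mul (polyGrowth_log_of_add_log_eq hψ)).mono
      (by norm_num)).add ((polyGrowth_rpow_mul_eval hψ h1 P.2).mono (by norm_num))
  · exact ((polyGrowth_of_add_log_eq hψ).mul (polyGrowth_log_of_add_log_eq hψ)).mono (by norm_num)
  · have h0 := (hψ x).1
    refine ((hasDerivAt_of_add_log_eq hψ x).mul
      (hasDerivAt_log_of_add_log_eq hψ x)).congr_deriv ?_
    simp

theorem exists_isSymbol_divergence
    (hψ : ∀ z : ℝ, 0 < ψ z ∧ ψ z + Real.log (ψ z) = z) {α : ℝ} (hα : α ∈ Icc (-1 : ℝ) 1) :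
    ∃ A B f g : ℝ → ℝ, IsSymbol 2 1 A ∧ IsSymbol 2 1 B ∧ IsSymbol 1 0 f ∧ IsSymbol 1 0 g ∧
      ∀ x y, A x + B y + f x * g y =
        if α = -1 then ψ y - ψ x + ψ x * Real.log (ψ x / ψ y)
        else if α = 1 then ψ x - ψ y + ψ y * Real.log (ψ y / ψ x)
        else (2 / (1 + α)) * ψ x + (2 / (1 - α)) * ψ y -
          (4 / (1 - α ^ 2)) * ψ x ^ ((1 - α) / 2) * ψ y ^ ((1 + α) / 2) := by
  have hs := isSymbol_of_add_log_eq hψ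
  have hs2 : IsSymbol 2 1 ψ := hs.mono (by norm_num) (by norm_num)
  have hn := hs.const_mul (-1)
  have hE := (isSymbol_mul_log hψ).add (hs2.const_mul (-1))
  have hlog (x y : ℝ) : Real.log (ψ x / ψ y) = Real.log (ψ x) - Real.log (ψ y) :=
    Real.log_div (hψ x).1.ne' (hψ y).1.ne'
  split_ifs with h1 h2
  · refine ⟨_, _, _, _, hE, hs2, hn, isSymbol_log hψ, fun x y => ?_⟩
    rw [hlog]
    ring
  · refine ⟨_, _, _, _, hs2, hE, isSymbol_log hψ, hn, fun x y => ?_⟩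
    rw [hlog]
    ring
  · refine ⟨_, _, _, _, hs2.const_mul (2 / (1 + α)), hs2.const_mul (2 / (1 - α)),
      (isSymbol_rpow hψ (s := (1 - α) / 2) ?_).const_mul (-(4 / (1 - α ^ 2))),
      isSymbol_rpow hψ (s := (1 + α) / 2) ?_, fun x y => ?_⟩
    · constructor <;> linarith [hα.1, hα.2]
    · constructor <;> linarith [hα.1, hα.2]
    · ring

end DeformedExponential

end

/-- Corollary 4.1: for every `α ∈ [−1,1]` and all `0 ≤ i,j ≤ ⌊λ⌋−1` with
`i+j ≤ ⌈λ⌉−1`, the `α`-divergence expressed in the chart `φ̃`, i.e. the map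
`(ã,b̃) ↦ D_α(φ̃^{-1}(ã) | φ̃^{-1}(b̃))` on `L^λ(μ) × L^λ(μ)` (with densities `p = ψ∘ã`,
`q = ψ∘b̃`), is of class `C^{i,j}`: it admits continuous partial Fréchet derivatives of
order `i` in the first variable and order `j` in the second. -/
theorem stmt_14 {X : Type*} [MeasurableSpace X] (μ : Measure X) [IsProbabilityMeasure μ]
    (lam : ℝ) (hlam : 2 ≤ lam) [Fact (1 ≤ ENNReal.ofReal lam)]
    (ψ : ℝ → ℝ) (hψ : ∀ z : ℝ, 0 < ψ z ∧ ψ z + Real.log (ψ z) = z)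
    (α : ℝ) (hα : α ∈ Icc (-1 : ℝ) 1)
    (Dv : Lp ℝ (ENNReal.ofReal lam) μ → Lp ℝ (ENNReal.ofReal lam) μ → ℝ)
    (hDv : ∀ a b : Lp ℝ (ENNReal.ofReal lam) μ, Dv a b =
      if α = -1 then
        ∫ x, (ψ (b x) - ψ (a x) + ψ (a x) * Real.log (ψ (a x) / ψ (b x))) ∂μ
      else if α = 1 then
        ∫ x, (ψ (a x) - ψ (b x) + ψ (b x) * Real.log (ψ (b x) / ψ (a x))) ∂μ
      else
        ∫ x, ((2 / (1 + α)) * ψ (a x) + (2 / (1 - α)) * ψ (b x) -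
          (4 / (1 - α ^ 2)) * ψ (a x) ^ ((1 - α) / 2) * ψ (b x) ^ ((1 + α) / 2)) ∂μ) :
    ∀ i j : ℕ, (i : ℤ) ≤ ⌊lam⌋ - 1 → (j : ℤ) ≤ ⌊lam⌋ - 1 → (i + j : ℤ) ≤ ⌈lam⌉ - 1 →
      -- i times continuously differentiable in the first variable
      (∀ b : Lp ℝ (ENNReal.ofReal lam) μ, ContDiff ℝ i (fun a => Dv a b)) ∧
      -- D₁^i(Dv) is j times continuously differentiable in the second variable
      (∀ a : Lp ℝ (ENNReal.ofReal lam) μ,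
        ContDiff ℝ j (fun b => iteratedFDeriv ℝ i (fun a' => Dv a' b) a)) ∧
      -- joint continuity of the mixed partial derivative D₁^iD₂^j(Dv)
      (Continuous fun q : Lp ℝ (ENNReal.ofReal lam) μ × Lp ℝ (ENNReal.ofReal lam) μ =>
        iteratedFDeriv ℝ j (fun b => iteratedFDeriv ℝ i (fun a' => Dv a' b) q.1) q.2) := by
  intro i j hi hj hij
  have hi' : (i : ℝ) + 1 ≤ lam := by
    have : ((i + 1 : ℤ) : ℝ) ≤ lam := Int.le_floor.1 (by omega)
    push_cast at this
    exact this
  have hj' : (j : ℝ) + 1 ≤ lam := by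
    have : ((j + 1 : ℤ) : ℝ) ≤ lam := Int.le_floor.1 (by omega)
    push_cast at this
    exact this
  have hij' : ((i + j : ℕ) : ℝ) < lam := by
    have : ((i + j : ℤ) : ℝ) < lam := Int.lt_ceil.1 (by omega)
    push_cast at this ⊢
    exact this
  obtain ⟨A, B, f, g, hA, hB, hf, hg, hF⟩ := exists_isSymbol_divergence hψ hα
  have jet := isJetFamily_of_isSymbol hlam hA hB hf hg
  set F : ℕ → ℕ → ℝ → ℝ → ℝ := fun i j x y => (if j = 0 then iteratedDeriv i A x else 0) +
      (if i = 0 then iteratedDeriv j B y else 0) + iteratedDeriv i f x * iteratedDeriv j g y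
  have hD : Dv = fun a b => ∫ x, F 0 0 (a x) (b x) ∂μ := by
    funext a b
    have hF0 (x y : ℝ) : F 0 0 x y = A x + B y + f x * g y := by simp [F]
    simp only [hDv, hF0, hF]
    split_ifs <;> rfl
  rw [hD]
  exact ⟨fun b => (jet.hasFTaylorSeriesUpTo_fst hi' b).contDiff,
    fun a => (jet.hasFTaylorSeriesUpTo_snd hi' hj' hij' a).contDiff,
    jet.continuous_iteratedFDeriv hi' hj' hij'⟩
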